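/- For every integer n ≥ 4, the Folklore set FS_n = Di_n \ (Bad_n ∪ Sing_n) in the dual approximation setting with maximum norm has Hausdorff dimension at least n − 2. -/

import Mathlib

open Filter MeasureTheory
open scoped ENNReal

/-- `ψ_ξ(t)`: the minimum of `|b₁ξ₁+⋯+b_nξ_n+b_{n+1}|` over integer vectors
`(b₁,…,b_{n+1})` with `1 ≤ max_i |b_i| ≤ t` (dual approximation, maximum norm). -/
noncomputable def psiDual (n : ℕ) (ξ : Fin n → ℝ) (t : ℝ) : ℝ :=
  sInf { r : ℝ | ∃ (b : Fin n → ℤ) (b' : ℤ),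
    (∃ i, b i ≠ 0) ∧ (∀ i, |(b i : ℝ)| ≤ t) ∧
    r = |(∑ i, (b i : ℝ) * ξ i) + (b' : ℝ)| }

/-- `Θ(ξ) = limsup_{t→∞} tⁿ ψ_ξ(t)`. -/
noncomputable def ThetaDual (n : ℕ) (ξ : Fin n → ℝ) : ℝ :=
  limsup (fun t : ℝ => t ^ n * psiDual n ξ t) atTop

/-- `Θ̃(ξ) = liminf_{t→∞} tⁿ ψ_ξ(t)`. -/
noncomputable def ThetaTildeDual (n : ℕ) (ξ : Fin n → ℝ) : ℝ :=
  liminf (fun t : ℝ => t ^ n * psiDual n ξ t) atTop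

/-- The Folklore set `FS_n = Di_n \ (Bad_n ∪ Sing_n)`. -/
def FSdual (n : ℕ) : Set (Fin n → ℝ) :=
  {ξ | ThetaDual n ξ < 1} \
    ({ξ | 0 < ThetaTildeDual n ξ} ∪ {ξ | ThetaDual n ξ = 0})

theorem exists_lacunary_series {β : ℕ} (hβ : 2 ≤ β) {a : ℕ → ℕ} (ha : StrictMono a) :
    ∃ x : ℝ, ∀ k, ∃ p : ℤ, IsCoprime p (β : ℤ) ∧
      1 / (β : ℝ) ^ a (k + 1) ≤ x - p / (β : ℝ) ^ a k ∧
      x - p / (β : ℝ) ^ a k ≤ 2 / (β : ℝ) ^ a (k + 1) := by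
  have hβ' : (2 : ℝ) ≤ β := by exact_mod_cast hβ
  have hβ0 : (0 : ℝ) < β := by linarith
  have hinv : 1 / (β : ℝ) ≤ 1 / 2 := one_div_le_one_div_of_le two_pos hβ'
  have hinv0 : 0 ≤ 1 / (β : ℝ) := by positivity
  have htail : ∀ i j, (1 / (β : ℝ)) ^ a (j + i) ≤ (1 / (β : ℝ)) ^ a i * (1 / 2) ^ j := by
    intro i j
    have h : a i + j ≤ a (j + i) := by
      rw [add_comm]
      exact ha.add_le_nat j i
    calc (1 / (β : ℝ)) ^ a (j + i) ≤ (1 / (β : ℝ)) ^ (a i + j) :=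
          pow_le_pow_of_le_one hinv0 (by linarith) h
      _ = (1 / (β : ℝ)) ^ a i * (1 / (β : ℝ)) ^ j := pow_add _ _ _
      _ ≤ _ := by gcongr
  have hs : ∀ i, Summable fun j => (1 / (β : ℝ)) ^ a (j + i) := fun i =>
    Summable.of_nonneg_of_le (fun j => by positivity) (htail i)
      (summable_geometric_two.mul_left _)
  have hpartial : ∀ k, ∃ p : ℤ, IsCoprime p (β : ℤ) ∧
      ∑ j ∈ Finset.range (k + 1), (1 / (β : ℝ)) ^ a j = p / (β : ℝ) ^ a k := by
    intro k
    induction k with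
    | zero => exact ⟨1, isCoprime_one_left, by simp⟩
    | succ k ih =>
      obtain ⟨p, -, hp⟩ := ih
      obtain ⟨d, hd⟩ := Nat.exists_eq_add_of_lt (ha (Nat.lt_succ_self k))
      refine ⟨p * (β : ℤ) ^ (d + 1) + 1, ⟨1, -(p * (β : ℤ) ^ d), by ring⟩, ?_⟩
      rw [Finset.sum_range_succ, hp]
      have hd' : a (k + 1) = a k + (d + 1) := by simpa [add_assoc] using hd
      rw [hd']
      push_cast
      rw [one_div_pow, pow_add]
      field_simp
  refine ⟨∑' j, (1 / (β : ℝ)) ^ a j, fun k => ?_⟩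
  obtain ⟨p, hpc, hp⟩ := hpartial k
  refine ⟨p, hpc, ?_⟩
  have hsplit := (hs 0).sum_add_tsum_nat_add (k + 1)
  simp only [add_zero] at hsplit
  rw [← hsplit, hp, add_sub_cancel_left, ← one_div_pow]
  constructor
  · simpa using (hs (k + 1)).le_tsum 0 (fun j _ => by positivity)
  · calc ∑' j, (1 / (β : ℝ)) ^ a (j + (k + 1))
        ≤ ∑' j, (1 / (β : ℝ)) ^ a (k + 1) * (1 / 2) ^ j :=
          (hs (k + 1)).tsum_le_tsum (htail (k + 1)) (summable_geometric_two.mul_left _)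
      _ = 2 / (β : ℝ) ^ a (k + 1) := by
          rw [tsum_mul_left, tsum_geometric_two, one_div_pow]; ring

/-- Exponents for the denominators `2 ^ A k` and `3 ^ B k` of rational approximations. -/
def interlacedExponents (n : ℕ) : ℕ → ℕ × ℕ
  | 0 => (0, 0)
  | k + 1 =>
    let A := (interlacedExponents n k).1 + 2 * n * (interlacedExponents n k).2 + k + 3
    (A, (interlacedExponents n k).2 + Nat.clog 3 (8 * (2 ^ A) ^ n))

theorem exists_interlaced_exponents (n : ℕ) : ∃ A B : ℕ → ℕ, StrictMono A ∧ StrictMono B ∧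
    A 0 = 0 ∧ B 0 = 0 ∧ ∀ k,
      8 * 2 ^ k * 2 ^ A k * (3 ^ B k) ^ n ≤ 2 ^ A (k + 1) ∧
      8 * 3 ^ B k * (2 ^ A (k + 1)) ^ n ≤ 3 ^ B (k + 1) ∧
      3 ^ B (k + 1) ≤ 24 * 3 ^ B k * (2 ^ A (k + 1)) ^ n := by
  set A : ℕ → ℕ := fun k => (interlacedExponents n k).1 with hA
  set B : ℕ → ℕ := fun k => (interlacedExponents n k).2 with hB
  have hAs : ∀ k, A (k + 1) = A k + 2 * n * B k + k + 3 := fun k => rfl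
  have hBs : ∀ k, B (k + 1) = B k + Nat.clog 3 (8 * (2 ^ A (k + 1)) ^ n) := fun k => rfl
  have hX : ∀ k, 1 < 8 * (2 ^ A (k + 1)) ^ n := fun k => by
    have : 0 < (2 ^ A (k + 1)) ^ n := by positivity
    omega
  have hclog : ∀ k, 0 < Nat.clog 3 (8 * (2 ^ A (k + 1)) ^ n) := fun k =>
    Nat.clog_pos (by norm_num) (hX k)
  refine ⟨A, B, strictMono_nat_of_lt_succ fun k => ?_, strictMono_nat_of_lt_succ fun k => ?_,
    rfl, rfl, fun k => ⟨?_, ?_, ?_⟩⟩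
  · rw [hAs]; omega
  · rw [hBs]; have := hclog k; omega
  · calc 8 * 2 ^ k * 2 ^ A k * (3 ^ B k) ^ n ≤ 8 * 2 ^ k * 2 ^ A k * ((2 ^ 2) ^ B k) ^ n := by
          gcongr; norm_num
      _ = 2 ^ A (k + 1) := by
          rw [hAs, ← pow_mul, ← pow_mul, show (8 : ℕ) = 2 ^ 3 by norm_num, ← pow_add, ← pow_add,
            ← pow_add]
          congr 1; ring
  · have := Nat.le_pow_clog (b := 3) (by norm_num) (8 * (2 ^ A (k + 1)) ^ n)
    rw [hBs k, pow_add]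
    calc _ = 3 ^ B k * (8 * (2 ^ A (k + 1)) ^ n) := by ring
      _ ≤ _ := by gcongr
  · have := Nat.pow_pred_clog_lt_self (b := 3) (by norm_num) (hX k)
    obtain ⟨c, hc⟩ := Nat.exists_eq_succ_of_ne_zero (hclog k).ne'
    rw [hc, Nat.pred_succ] at this
    rw [hBs k, pow_add, hc, pow_succ]
    calc _ ≤ 3 ^ B k * (8 * (2 ^ A (k + 1)) ^ n * 3) := by gcongr
      _ = _ := by ring

theorem min_le_abs_linear_form {q r p s : ℤ} (hq : 0 < q) (hr : 0 < r) (hpq : IsCoprime p q)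
    (hsr : IsCoprime s r) (hqr : IsCoprime q r) {x y δ : ℝ}
    (hx0 : 0 ≤ x - p / q) (hx : (x - p / q) * (4 * q ^ 2 * r) ≤ 1)
    (hδ : 0 ≤ δ) (hy0 : δ ≤ y - s / r) (hy : (y - s / r) * (4 * q ^ 2 * r) ≤ 1)
    {b₁ b₂ b₀ : ℤ} (hb₁ : |b₁| < q) (hb₂ : |b₂| < q) (hb : b₁ ≠ 0 ∨ b₂ ≠ 0) :
    min (1 / (2 * (q : ℝ) * r)) (r * δ) ≤ |b₁ * x + b₂ * y + b₀| := by
  have hq' : (0 : ℝ) < q := by exact_mod_cast hq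
  have hr' : (0 : ℝ) < r := by exact_mod_cast hr
  have hb₁' : |(b₁ : ℝ)| ≤ q := by exact_mod_cast hb₁.le
  have hb₂' : |(b₂ : ℝ)| ≤ q := by exact_mod_cast hb₂.le
  set u := x - p / q with hu
  set v := y - s / r with hv
  set N : ℤ := b₁ * p * r + b₂ * s * q + b₀ * q * r with hN
  have hform : b₁ * x + b₂ * y + b₀ = N / (q * r) + (b₁ * u + b₂ * v) := by
    rw [hu, hv, hN]; push_cast; field_simp; ring
  rw [hform]
  by_cases hN0 : N = 0
  · have hq1 : q ∣ b₁ * (p * r) := ⟨-(b₂ * s + b₀ * r), by linear_combination hN0 - hN⟩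
    have hb₁0 : b₁ = 0 := by
      refine Int.eq_zero_of_abs_lt_dvd ?_ hb₁
      exact (hpq.symm.mul_right hqr).dvd_of_dvd_mul_right hq1
    have hr1 : r ∣ b₂ * (s * q) := ⟨-(b₁ * p + b₀ * q), by linear_combination hN0 - hN⟩
    have hr2 : r ∣ b₂ := (hsr.symm.mul_right hqr.symm).dvd_of_dvd_mul_right hr1
    have hb₂0 : b₂ ≠ 0 := by simpa [hb₁0] using hb
    have hrb : r ≤ |b₂| := Int.le_of_dvd (abs_pos.mpr hb₂0) ((dvd_abs _ _).mpr hr2)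
    have hrb' : (r : ℝ) ≤ |(b₂ : ℝ)| := by exact_mod_cast hrb
    refine (min_le_right _ _).trans ?_
    rw [hN0, hb₁0]
    simp only [Int.cast_zero, zero_div, zero_mul, zero_add, abs_mul]
    rw [abs_of_nonneg (hδ.trans hy0)]
    gcongr
  · refine (min_le_left _ _).trans ?_
    have h1 : (1 : ℝ) ≤ |(N : ℝ)| := by exact_mod_cast Int.one_le_abs hN0
    have hE : |b₁ * u + b₂ * v| ≤ 1 / (2 * (q : ℝ) * r) := by
      have hv0 := hδ.trans hy0
      calc |b₁ * u + b₂ * v| ≤ |b₁ * u| + |b₂ * v| := abs_add_le _ _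
        _ = |(b₁ : ℝ)| * u + |(b₂ : ℝ)| * v := by
            rw [abs_mul, abs_mul, abs_of_nonneg hx0, abs_of_nonneg hv0]
        _ ≤ q * u + q * v := by gcongr
        _ ≤ _ := by
            rw [le_div_iff₀ (by positivity)]
            linarith
    have hM : 1 / ((q : ℝ) * r) ≤ |(N : ℝ) / (q * r)| := by
      rw [abs_div, abs_of_pos (mul_pos hq' hr')]
      gcongr
    have h3 := abs_sub_abs_le_abs_sub ((N : ℝ) / (q * r)) (-(b₁ * u + b₂ * v))
    rw [abs_neg, sub_neg_eq_add] at h3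
    have h4 : 1 / ((q : ℝ) * r) = 1 / (2 * (q : ℝ) * r) + 1 / (2 * (q : ℝ) * r) := by
      field_simp; norm_num
    linarith

theorem restrict_unitInterval_slab_le {b : ℤ} (hb : b ≠ 0) (α : ℝ) {ε : ℝ} (hε0 : 0 ≤ ε)
    (hε1 : ε ≤ 1) :
    (volume.restrict (Set.Icc (0 : ℝ) 1)) {x | ∃ c : ℤ, |α + b * x + c| < ε} ≤
      ENNReal.ofReal (10 * ε) := by
  have hb1 : (1 : ℝ) ≤ |(b : ℝ)| := by exact_mod_cast Int.one_le_abs hb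
  have hb0 : (b : ℝ) ≠ 0 := by exact_mod_cast hb
  rw [Measure.restrict_apply' measurableSet_Icc]
  set I : Finset ℤ := Finset.Icc ⌈-α - |(b : ℝ)| - 1⌉ ⌊-α + |(b : ℝ)| + 1⌋ with hI
  have hsub : {x | ∃ c : ℤ, |α + b * x + c| < ε} ∩ Set.Icc (0 : ℝ) 1 ⊆
      ⋃ c ∈ I, Metric.ball (-(α + c) / b) (ε / |(b : ℝ)|) := by
    rintro x ⟨⟨c, hc⟩, hx0, hx1⟩
    have hbx : |b * x| ≤ |(b : ℝ)| := by
      rw [abs_mul, abs_of_nonneg hx0]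
      exact mul_le_of_le_one_right (abs_nonneg _) hx1
    have h1 := abs_lt.mp hc
    have h2 := abs_le.mp hbx
    refine Set.mem_biUnion (x := c) ?_ ?_
    · simp only [hI, Finset.coe_Icc, Set.mem_Icc, Int.ceil_le, Int.le_floor]
      constructor <;> linarith
    · rw [Metric.mem_ball, Real.dist_eq, lt_div_iff₀ (by linarith), ← abs_mul]
      have h3 : (x - -(α + c) / b) * b = α + b * x + c := by field_simp; ring
      rwa [h3]
  have hcard : (I.card : ℝ) ≤ 5 * |(b : ℝ)| := by
    have h1 : (⌊-α + |(b : ℝ)| + 1⌋ : ℝ) ≤ _ := Int.floor_le _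
    have h2 : -α - |(b : ℝ)| - 1 ≤ ⌈-α - |(b : ℝ)| - 1⌉ := Int.le_ceil _
    rw [hI, Int.card_Icc]
    have h3 : (((⌊-α + |(b : ℝ)| + 1⌋ + 1 - ⌈-α - |(b : ℝ)| - 1⌉).toNat : ℤ) : ℝ) ≤
        5 * |(b : ℝ)| := by
      rw [Int.toNat_eq_max, Int.cast_max]
      push_cast
      refine max_le ?_ (by positivity)
      linarith
    exact_mod_cast h3
  calc _ ≤ volume (⋃ c ∈ I, Metric.ball (-(α + c) / b) (ε / |(b : ℝ)|)) := measure_mono hsub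
    _ ≤ ∑ c ∈ I, volume (Metric.ball (-(α + c) / b) (ε / |(b : ℝ)|)) :=
        measure_biUnion_finset_le _ _
    _ = ENNReal.ofReal (I.card * (2 * (ε / |(b : ℝ)|))) := by
        rw [Finset.sum_congr rfl fun c _ => Real.volume_ball _ _, Finset.sum_const, nsmul_eq_mul,
          ENNReal.ofReal_mul (Nat.cast_nonneg I.card), ENNReal.ofReal_natCast]
    _ ≤ ENNReal.ofReal (10 * ε) := by
        refine ENNReal.ofReal_le_ofReal ?_
        calc _ ≤ 5 * |(b : ℝ)| * (2 * (ε / |(b : ℝ)|)) := by gcongr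
          _ = 10 * ε := by field_simp; ring

theorem isOpen_slab {m : ℕ} (b : Fin m → ℤ) (α ε : ℝ) :
    IsOpen {η : Fin m → ℝ | ∃ c : ℤ, |α + ∑ i, (b i : ℝ) * η i + c| < ε} := by
  simp only [Set.ofPred_exists]
  exact isOpen_iUnion fun c => isOpen_lt (by fun_prop) continuous_const

theorem pi_unitInterval_slab_le {m : ℕ} {b : Fin m → ℤ} (hb : b ≠ 0) (α : ℝ) {ε : ℝ}
    (hε0 : 0 ≤ ε) (hε1 : ε ≤ 1) :
    (Measure.pi fun _ : Fin m => volume.restrict (Set.Icc (0 : ℝ) 1))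
      {η | ∃ c : ℤ, |α + ∑ i, (b i : ℝ) * η i + c| < ε} ≤ ENNReal.ofReal (10 * ε) := by
  obtain ⟨j, hj⟩ := Function.ne_iff.mp hb
  obtain _ | m := m
  · exact j.elim0
  have hprob : IsProbabilityMeasure (volume.restrict (Set.Icc (0 : ℝ) 1)) := ⟨by simp⟩
  have hmp := (measurePreserving_piFinSuccAbove
    (fun _ : Fin (m + 1) => volume.restrict (Set.Icc (0 : ℝ) 1)) j).symm
  rw [← hmp.measure_preimage_equiv,
    Measure.prod_apply_symm (hmp.measurable (isOpen_slab b α ε).measurableSet)]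
  calc _ ≤ ∫⁻ _ : Fin m → ℝ, ENNReal.ofReal (10 * ε)
        ∂(Measure.pi fun _ => volume.restrict (Set.Icc (0 : ℝ) 1)) := by
        refine lintegral_mono fun z => ?_
        refine le_trans (measure_mono ?_) (restrict_unitInterval_slab_le (b := b j) hj
          (α + ∑ i, (b (j.succAbove i) : ℝ) * z i) hε0 hε1)
        rintro x ⟨c, hc⟩
        refine ⟨c, ?_⟩
        change |α + ∑ i, (b i : ℝ) * j.insertNth (α := fun _ => ℝ) x z i + c| < ε at hc
        rw [Fin.sum_univ_succAbove _ j] at hc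
        simp only [Fin.insertNth_apply_same, Fin.insertNth_apply_succAbove] at hc
        convert hc using 3
        ring
    _ = _ := by simp

/-- Points of `ℝᵐ` for which some integer combination of bounded height, with nonzero part
along `ℝᵐ`, is small. -/
def resonantSet (m : ℕ) (x y : ℝ) (Q : ℕ) (ε : ℝ) : Set (Fin m → ℝ) :=
  {η | ∃ (b : Fin (m + 2) → ℤ) (c : ℤ), Fin.tail (Fin.tail b) ≠ 0 ∧ (∀ i, |b i| ≤ Q) ∧
    |∑ i, (b i : ℝ) * (Matrix.vecCons x (Matrix.vecCons y η)) i + c| < ε}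

theorem resonantSet_eq (m : ℕ) (x y : ℝ) (Q : ℕ) (ε : ℝ) :
    resonantSet m x y Q ε =
      ⋃ b ∈ (Fintype.piFinset fun _ : Fin (m + 2) => Finset.Icc (-(Q : ℤ)) Q).filter
        (fun b => Fin.tail (Fin.tail b) ≠ 0),
      {η | ∃ c : ℤ, |(b 0 * x + b 1 * y) +
        ∑ i, (Fin.tail (Fin.tail b) i : ℝ) * η i + c| < ε} := by
  ext η
  simp only [resonantSet, Set.mem_ofPred_eq, Set.mem_iUnion, Finset.mem_filter,
    Fintype.mem_piFinset, Finset.mem_Icc, ← abs_le, Fin.sum_univ_succ, exists_prop, Fin.tail,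
    Matrix.cons_val_zero, Matrix.cons_val_succ, Fin.succ_zero_eq_one, add_assoc]
  refine exists_congr fun b => ?_
  constructor
  · rintro ⟨c, h1, h2, h3⟩
    exact ⟨⟨h2, h1⟩, c, h3⟩
  · rintro ⟨⟨h2, h1⟩, c, h3⟩
    exact ⟨c, h1, h2, h3⟩

theorem measurableSet_resonantSet (m : ℕ) (x y : ℝ) (Q : ℕ) (ε : ℝ) :
    MeasurableSet (resonantSet m x y Q ε) := by
  rw [resonantSet_eq]
  exact Finset.measurableSet_biUnion _ fun b _ => (isOpen_slab _ _ _).measurableSet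

theorem measure_resonantSet_le (m : ℕ) (x y : ℝ) {Q : ℕ} (hQ : 1 ≤ Q) :
    (Measure.pi fun _ : Fin m => volume.restrict (Set.Icc (0 : ℝ) 1))
      (resonantSet m x y Q (1 / (20 * (3 * Q) ^ (m + 2)))) ≤ 1 / 2 := by
  have hQ' : (1 : ℝ) ≤ Q := by exact_mod_cast hQ
  set ε : ℝ := 1 / (20 * (3 * Q) ^ (m + 2)) with hε
  have hε0 : 0 ≤ ε := by positivity
  have hε1 : ε ≤ 1 := by
    rw [hε, div_le_one (by positivity)]
    have : (1 : ℝ) ≤ (3 * Q) ^ (m + 2) := one_le_pow₀ (by linarith)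
    linarith
  rw [resonantSet_eq]
  refine (measure_biUnion_finset_le _ _).trans ?_
  refine (Finset.sum_le_card_nsmul _ _ (ENNReal.ofReal (10 * ε)) fun b hb =>
    pi_unitInterval_slab_le (Finset.mem_filter.mp hb).2 _ hε0 hε1).trans ?_
  have hcard : (((Fintype.piFinset fun _ : Fin (m + 2) => Finset.Icc (-(Q : ℤ)) Q).filter
      (fun b => Fin.tail (Fin.tail b) ≠ 0)).card : ℝ) ≤ (3 * Q) ^ (m + 2) := by
    have h : ((Fintype.piFinset fun _ : Fin (m + 2) => Finset.Icc (-(Q : ℤ)) Q).filter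
        (fun b => Fin.tail (Fin.tail b) ≠ 0)).card ≤ (3 * Q) ^ (m + 2) := by
      refine (Finset.card_filter_le _ _).trans ?_
      rw [Fintype.card_piFinset_const, Int.card_Icc]
      refine Nat.pow_le_pow_left ?_ _
      omega
    exact_mod_cast h
  rw [nsmul_eq_mul, ← ENNReal.ofReal_natCast, ← ENNReal.ofReal_mul (by positivity)]
  rw [show (1 / 2 : ℝ≥0∞) = ENNReal.ofReal (1 / 2) by
    rw [ENNReal.ofReal_div_of_pos two_pos]; simp]
  refine ENNReal.ofReal_le_ofReal ?_
  calc _ ≤ (3 * (Q : ℝ)) ^ (m + 2) * (10 * ε) := by gcongr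
    _ = 1 / 2 := by rw [hε]; field_simp; norm_num

theorem frequently_notMem_ne_zero {X : Type*} [MeasurableSpace X] {μ : Measure X}
    [IsProbabilityMeasure μ] {E : ℕ → Set X} (hE : ∀ k, MeasurableSet (E k))
    (hμ : ∀ k, μ (E k) ≤ 1 / 2) : μ {η | ∃ᶠ k in atTop, η ∉ E k} ≠ 0 := by
  have heq : {η | ∃ᶠ k in atTop, η ∉ E k} = ⋂ N, ⋃ k ≥ N, (E k)ᶜ := by
    ext η
    simp [frequently_atTop]
  have hlim := tendsto_measure_iInter_atTop (μ := μ) (s := fun N => ⋃ k ≥ N, (E k)ᶜ)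
    (fun N => (MeasurableSet.biUnion (Set.to_countable _)
      fun k _ => (hE k).compl).nullMeasurableSet)
    (fun M N hMN => Set.biUnion_subset_biUnion_left fun k (hk : N ≤ k) => hMN.trans hk)
    ⟨0, measure_ne_top _ _⟩
  rw [heq]
  have : (1 / 2 : ℝ≥0∞) ≤ μ (⋂ N, ⋃ k ≥ N, (E k)ᶜ) := by
    refine ge_of_tendsto' hlim fun N => ?_
    calc (1 / 2 : ℝ≥0∞) = 1 - 1 / 2 := by simp
      _ ≤ 1 - μ (E N) := tsub_le_tsub_left (hμ N) _
      _ = μ (E N)ᶜ := (prob_compl_eq_one_sub (hE N)).symm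
      _ ≤ _ := measure_mono (Set.subset_biUnion_of_mem (u := fun k => (E k)ᶜ) (le_refl N))
  intro h0
  simp [h0] at this

theorem exists_interlaced_approximations (m : ℕ) : ∃ (x y : ℝ) (q r : ℕ → ℕ), StrictMono q ∧
    (∀ k, 1 ≤ q k ∧ q k ≤ r k) ∧
    (∀ k, ∃ p : ℤ, (r k : ℝ) ^ (m + 2) * |q k * x + p| ≤ 1 / 4 * (1 / 2) ^ k) ∧
    (∀ k, ∃ s : ℤ, (q (k + 1) : ℝ) ^ (m + 2) * |r k * y + s| ≤ 1 / 4) ∧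
    ∀ k (b₁ b₂ b₀ : ℤ), |b₁| < q (k + 1) → |b₂| < q (k + 1) → b₁ ≠ 0 ∨ b₂ ≠ 0 →
      1 / (24 * (q (k + 1) : ℝ) ^ (m + 2)) ≤ |b₁ * x + b₂ * y + b₀| := by
  obtain ⟨A, B, hA, hB, hA0, hB0, hAB⟩ := exists_interlaced_exponents (m + 2)
  obtain ⟨x, hx⟩ := exists_lacunary_series le_rfl hA
  obtain ⟨y, hy⟩ := exists_lacunary_series (β := 3) (by norm_num) hB
  push_cast at hx hy
  have hAB' : ∀ k, 8 * (2 : ℝ) ^ k * 2 ^ A k * (3 ^ B k) ^ (m + 2) ≤ 2 ^ A (k + 1) ∧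
      8 * (3 : ℝ) ^ B k * (2 ^ A (k + 1)) ^ (m + 2) ≤ 3 ^ B (k + 1) ∧
      (3 : ℝ) ^ B (k + 1) ≤ 24 * 3 ^ B k * (2 ^ A (k + 1)) ^ (m + 2) := fun k => by
    exact_mod_cast hAB k
  have hq1 : ∀ k, (1 : ℝ) ≤ 2 ^ A k := fun k => one_le_pow₀ (by norm_num)
  have hr1 : ∀ k, (1 : ℝ) ≤ 3 ^ B k := fun k => one_le_pow₀ (by norm_num)
  have hqr : ∀ k, (2 : ℝ) ^ A k ≤ 3 ^ B k := by
    rintro (_ | k)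
    · simp [hA0, hB0]
    · calc (2 : ℝ) ^ A (k + 1) ≤ (2 ^ A (k + 1)) ^ (m + 2) := le_self_pow₀ (hq1 _) (by omega)
        _ ≤ 8 * (3 : ℝ) ^ B k * (2 ^ A (k + 1)) ^ (m + 2) :=
          le_mul_of_one_le_left (by positivity) (by linarith [hr1 k])
        _ ≤ _ := (hAB' k).2.1
  have hrq : ∀ k, 8 * (2 : ℝ) ^ A k * 3 ^ B k ≤ 2 ^ A (k + 1) := fun k => by
    refine le_trans ?_ (hAB' k).1
    have h2 : (3 : ℝ) ^ B k ≤ (3 ^ B k) ^ (m + 2) := le_self_pow₀ (hr1 _) (by omega)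
    have h3 : (1 : ℝ) ≤ 2 ^ k := one_le_pow₀ (by norm_num)
    calc 8 * (2 : ℝ) ^ A k * 3 ^ B k = 8 * 1 * (2 : ℝ) ^ A k * 3 ^ B k := by ring
      _ ≤ _ := by gcongr
  refine ⟨x, y, fun k => 2 ^ A k, fun k => 3 ^ B k, fun i j hij =>
    Nat.pow_lt_pow_right (by norm_num) (hA hij), fun k => ⟨Nat.one_le_two_pow, ?_⟩,
    fun k => ?_, fun k => ?_, fun k b₁ b₂ b₀ h₁ h₂ hb => ?_⟩
  · exact_mod_cast hqr k
  · obtain ⟨p, -, hp0, hp⟩ := hx k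
    refine ⟨-p, ?_⟩
    have hpos : 0 ≤ x - p / 2 ^ A k := le_trans (by positivity) hp0
    push_cast
    rw [show (2 : ℝ) ^ A k * x + -p = 2 ^ A k * (x - p / 2 ^ A k) by field_simp; ring,
      abs_of_nonneg (by positivity)]
    calc _ ≤ ((3 : ℝ) ^ B k) ^ (m + 2) * (2 ^ A k * (2 / 2 ^ A (k + 1))) := by gcongr
      _ = 1 / 4 * (1 / 2) ^ k * ((8 * 2 ^ k * 2 ^ A k * (3 ^ B k) ^ (m + 2)) / 2 ^ A (k + 1)) := by
          rw [one_div_pow]; field_simp; norm_num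
      _ ≤ 1 / 4 * (1 / 2) ^ k * 1 := by
          gcongr
          exact div_le_one_of_le₀ (hAB' k).1 (by positivity)
      _ = _ := mul_one _
  · obtain ⟨p, -, hp0, hp⟩ := hy k
    refine ⟨-p, ?_⟩
    have hpos : 0 ≤ y - p / 3 ^ B k := le_trans (by positivity) hp0
    push_cast
    rw [show (3 : ℝ) ^ B k * y + -p = 3 ^ B k * (y - p / 3 ^ B k) by field_simp; ring,
      abs_of_nonneg (by positivity)]
    calc _ ≤ ((2 : ℝ) ^ A (k + 1)) ^ (m + 2) * (3 ^ B k * (2 / 3 ^ B (k + 1))) := by gcongr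
      _ = 1 / 4 * ((8 * 3 ^ B k * (2 ^ A (k + 1)) ^ (m + 2)) / 3 ^ B (k + 1)) := by
          field_simp; norm_num
      _ ≤ 1 / 4 * 1 := by
          gcongr
          exact div_le_one_of_le₀ (hAB' k).2.1 (by positivity)
      _ = _ := mul_one _
  · obtain ⟨p, hpc, hp0, hp⟩ := hx (k + 1)
    obtain ⟨s, hsc, hs0, hs⟩ := hy k
    set q : ℝ := 2 ^ A (k + 1) with hq
    set r : ℝ := 3 ^ B k with hr
    have hq1' : 1 ≤ q := hq1 _
    have hr1' : 1 ≤ r := hr1 _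
    have hrq' : r ≤ q := by
      refine le_trans ?_ (hrq k)
      exact le_mul_of_one_le_left (by positivity) (by linarith [hq1 k])
    have hpow : q ^ 2 ≤ q ^ (m + 2) := pow_le_pow_right₀ hq1' (by omega)
    have hstep : 8 * q ^ 2 * r ≤ 3 ^ B (k + 1) := by
      refine le_trans ?_ (hAB' k).2.1
      rw [mul_right_comm]
      gcongr
    have hstep' : 8 * q ^ 2 * r ≤ 2 ^ A (k + 2) := by
      refine hstep.trans (le_trans ?_ (hrq (k + 1)))
      exact le_mul_of_one_le_left (by positivity) (by linarith [hq1 (k + 1)])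
    have key := min_le_abs_linear_form (q := 2 ^ A (k + 1)) (r := 3 ^ B k) (p := p) (s := s)
      (x := x) (y := y) (δ := 1 / 3 ^ B (k + 1)) (b₁ := b₁) (b₂ := b₂) (b₀ := b₀)
      (by positivity) (by positivity) hpc.pow_right hsc.pow_right
      (IsCoprime.pow (by norm_num : IsCoprime (2 : ℤ) 3))
      (by push_cast; exact le_trans (by positivity) hp0)
      (by
        push_cast
        calc _ ≤ 2 / (2 : ℝ) ^ A (k + 1 + 1) * (4 * q ^ 2 * r) := by gcongr
          _ = 8 * q ^ 2 * r / 2 ^ A (k + 2) := by ring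
          _ ≤ 1 := div_le_one_of_le₀ hstep' (by positivity))
      (by positivity) (by push_cast; exact hs0)
      (by
        push_cast
        calc _ ≤ 2 / (3 : ℝ) ^ B (k + 1) * (4 * q ^ 2 * r) := by gcongr
          _ = 8 * q ^ 2 * r / 3 ^ B (k + 1) := by ring
          _ ≤ 1 := div_le_one_of_le₀ hstep (by positivity))
      (by exact_mod_cast h₁) (by exact_mod_cast h₂) hb
    refine le_trans (le_min ?_ ?_) key
    · push_cast
      refine one_div_le_one_div_of_le (by positivity) ?_
      calc 2 * q * r ≤ 2 * q * q := by gcongr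
        _ = 2 * q ^ 2 := by ring
        _ ≤ 24 * q ^ (m + 2) := by linarith [sq_nonneg q]
    · push_cast
      rw [mul_one_div, div_le_div_iff₀ (by positivity) (by positivity)]
      have := (hAB' k).2.2
      linarith

theorem psiDual_nonneg (n : ℕ) (ξ : Fin n → ℝ) (t : ℝ) : 0 ≤ psiDual n ξ t := by
  refine Real.sInf_nonneg ?_
  rintro _ ⟨b, c, -, -, rfl⟩
  exact abs_nonneg _

theorem psiDual_le {n : ℕ} (ξ : Fin n → ℝ) {t : ℝ} {b : Fin n → ℤ} (hb : ∃ i, b i ≠ 0)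
    (hbt : ∀ i, |(b i : ℝ)| ≤ t) (c : ℤ) :
    psiDual n ξ t ≤ |(∑ i, (b i : ℝ) * ξ i) + (c : ℝ)| := by
  refine csInf_le ⟨0, ?_⟩ ⟨b, c, hb, hbt, rfl⟩
  rintro _ ⟨b, c, -, -, rfl⟩
  exact abs_nonneg _

theorem psiDual_le_single {n : ℕ} (ξ : Fin n → ℝ) {t : ℝ} (j : Fin n) {d : ℕ} (hd : 1 ≤ d)
    (hdt : d ≤ t) (c : ℤ) : psiDual n ξ t ≤ |d * ξ j + c| := by
  refine (psiDual_le ξ (b := Pi.single j (d : ℤ)) ⟨j, ?_⟩ (fun i => ?_) c).trans_eq ?_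
  · simp; omega
  · rcases eq_or_ne i j with rfl | h
    · simpa using hdt
    · simpa [h] using (Nat.cast_nonneg d).trans hdt
  · rw [Finset.sum_eq_single j (fun i _ h => by simp [h]) (by simp)]
    simp

theorem le_psiDual {n : ℕ} [NeZero n] {ξ : Fin n → ℝ} {t δ : ℝ} (ht : 1 ≤ t)
    (h : ∀ (b : Fin n → ℤ) (c : ℤ), (∃ i, b i ≠ 0) → (∀ i, |(b i : ℝ)| ≤ t) →
      δ ≤ |(∑ i, (b i : ℝ) * ξ i) + (c : ℝ)|) : δ ≤ psiDual n ξ t := by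
  refine le_csInf ⟨_, fun _ => 1, 0, ⟨0, one_ne_zero⟩, fun i => by simpa using ht, rfl⟩ ?_
  rintro _ ⟨b, c, hb, hbt, rfl⟩
  exact h b c hb hbt

theorem exists_le_lt_succ {q : ℕ → ℕ} (hq : StrictMono q) {t : ℝ} (ht : q 0 ≤ t) :
    ∃ k, q k ≤ t ∧ t < q (k + 1) := by
  have hex : ∃ k, t < q k := by
    obtain ⟨N, hN⟩ := exists_nat_gt t
    exact ⟨N, hN.trans_le (by exact_mod_cast hq.le_apply)⟩
  obtain ⟨k, hk, hmin⟩ : ∃ k, t < q k ∧ ∀ j < k, ¬ t < q j :=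
    ⟨Nat.find hex, Nat.find_spec hex, fun j => Nat.find_min hex⟩
  obtain _ | k := k
  · exact absurd hk ht.not_gt
  · exact ⟨k, not_lt.mp (hmin k k.lt_succ_self), hk⟩

theorem mem_FSdual_of_frequently {m : ℕ} {x y : ℝ} {q r : ℕ → ℕ} (hq : StrictMono q)
    (hqr : ∀ k, 1 ≤ q k ∧ q k ≤ r k)
    (hx : ∀ k, ∃ p : ℤ, (r k : ℝ) ^ (m + 2) * |q k * x + p| ≤ 1 / 4 * (1 / 2) ^ k)
    (hy : ∀ k, ∃ s : ℤ, (q (k + 1) : ℝ) ^ (m + 2) * |r k * y + s| ≤ 1 / 4)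
    (hxy : ∀ k (b₁ b₂ b₀ : ℤ), |b₁| < q (k + 1) → |b₂| < q (k + 1) → b₁ ≠ 0 ∨ b₂ ≠ 0 →
      1 / (24 * (q (k + 1) : ℝ) ^ (m + 2)) ≤ |b₁ * x + b₂ * y + b₀|)
    {η : Fin m → ℝ} (hη : ∃ᶠ k in atTop,
      η ∉ resonantSet m x y (q (k + 1)) (1 / (20 * (3 * (q (k + 1) : ℕ)) ^ (m + 2)))) :
    Matrix.vecCons x (Matrix.vecCons y η) ∈ FSdual (m + 2) := by
  set ξ : Fin (m + 2) → ℝ := Matrix.vecCons x (Matrix.vecCons y η) with hξ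
  set f : ℝ → ℝ := fun t => t ^ (m + 2) * psiDual (m + 2) ξ t with hf
  have hqpos : ∀ k, (1 : ℝ) ≤ q k := fun k => by exact_mod_cast (hqr k).1
  have hf0 : ∀ᶠ t in atTop, 0 ≤ f t := by
    filter_upwards [eventually_ge_atTop 0] with t ht
    exact mul_nonneg (pow_nonneg ht _) (psiDual_nonneg _ _ _)
  have hfx : ∀ k t, (q k : ℝ) ≤ t → t ≤ r k → f t ≤ 1 / 4 * (1 / 2) ^ k := by
    intro k t h1 h2
    obtain ⟨p, hp⟩ := hx k
    have h0 : 0 ≤ t := (Nat.cast_nonneg _).trans h1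
    refine le_trans ?_ hp
    have := psiDual_le_single ξ 0 (hqr k).1 h1 p
    have hnn := psiDual_nonneg (m + 2) ξ t
    simp only [hξ, Matrix.cons_val_zero] at this
    simp only [hf]
    gcongr
  have hfy : ∀ k t, (r k : ℝ) ≤ t → t ≤ q (k + 1) → f t ≤ 1 / 4 := by
    intro k t h1 h2
    obtain ⟨s, hs⟩ := hy k
    have h0 : 0 ≤ t := (Nat.cast_nonneg _).trans h1
    refine le_trans ?_ hs
    have := psiDual_le_single ξ 1 ((hqr k).1.trans (hqr k).2) h1 s
    have hnn := psiDual_nonneg (m + 2) ξ t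
    simp only [hξ, Matrix.cons_val_one, Matrix.cons_val_zero] at this
    simp only [hf]
    gcongr
  have hf1 : ∀ᶠ t in atTop, f t ≤ 1 / 4 := by
    filter_upwards [eventually_ge_atTop (q 0 : ℝ)] with t ht
    obtain ⟨k, hk1, hk2⟩ := exists_le_lt_succ hq ht
    rcases le_total t (r k) with h | h
    · refine (hfx k t hk1 h).trans (mul_le_of_le_one_right (by norm_num) ?_)
      exact pow_le_one₀ (by norm_num) (by norm_num)
    · exact hfy k t h hk2.le
  have hbdd_ge : IsBoundedUnder (· ≥ ·) atTop f := isBoundedUnder_of_eventually_ge hf0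
  have hbdd_le : IsBoundedUnder (· ≤ ·) atTop f := isBoundedUnder_of_eventually_le hf1
  have hq_tendsto : Tendsto (fun k => (q k : ℝ)) atTop atTop :=
    tendsto_natCast_atTop_atTop.comp hq.tendsto_atTop
  refine ⟨?_, ?_⟩
  · have h : limsup f atTop ≤ 1 / 4 := limsup_le_of_le hbdd_ge.isCoboundedUnder_le hf1
    exact h.trans_lt (by norm_num)
  rintro (hbad | hsing)
  · refine absurd (show 0 < liminf f atTop from hbad) (not_lt.mpr ?_)
    refine le_of_forall_pos_le_add fun ε hε => ?_
    rw [zero_add]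
    refine liminf_le_of_frequently_le ?_ hbdd_ge
    refine hq_tendsto.frequently (Eventually.frequently ?_)
    have hlim : Tendsto (fun k : ℕ => (1 / 4 : ℝ) * (1 / 2) ^ k) atTop (nhds (1 / 4 * 0)) :=
      (tendsto_pow_atTop_nhds_zero_of_lt_one (by norm_num) (by norm_num)).const_mul _
    rw [mul_zero] at hlim
    filter_upwards [hlim.eventually_le_const hε] with k hk
    exact (hfx k _ le_rfl (by exact_mod_cast (hqr k).2)).trans hk
  · have hpos : (0 : ℝ) < 1 / (24 * 6 ^ (m + 2)) := by positivity
    refine absurd (show limsup f atTop = 0 from hsing) (hpos.trans_le ?_).ne'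
    refine le_limsup_of_frequently_le ?_ hbdd_le
    have hhalf : Tendsto (fun k => (q (k + 1) : ℝ) / 2) atTop atTop :=
      (hq_tendsto.comp (tendsto_add_atTop_nat 1)).atTop_div_const two_pos
    refine hhalf.frequently ((hη.and_eventually (hhalf.eventually_ge_atTop 1)).mono ?_)
    rintro k ⟨hk, ht⟩
    set Q := q (k + 1) with hQ
    have hQ1 : (1 : ℝ) ≤ Q := hqpos _
    have hψ : 1 / (24 * (3 * (Q : ℝ)) ^ (m + 2)) ≤ psiDual (m + 2) ξ (Q / 2) := by
      refine le_psiDual ht fun b c hb hbt => ?_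
      have hbQ : ∀ i, |b i| < (Q : ℤ) := fun i => by
        have : |(b i : ℝ)| < Q := (hbt i).trans_lt (by linarith)
        exact_mod_cast this
      by_cases htail : Fin.tail (Fin.tail b) = 0
      · have hzero : ∀ i : Fin m, b i.succ.succ = 0 := fun i => congrFun htail i
        have hb01 : b 0 ≠ 0 ∨ b 1 ≠ 0 := by
          by_contra! hcon
          obtain ⟨i, hi⟩ := hb
          refine hi (Fin.cases hcon.1 (fun j => Fin.cases hcon.2 hzero j) i)
        refine le_trans ?_ ((hxy k (b 0) (b 1) c (hbQ 0) (hbQ 1) hb01).trans_eq ?_)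
        · gcongr
          linarith
        · rw [Fin.sum_univ_succ, Fin.sum_univ_succ]
          simp [hzero, hξ]
      · have hb' : ¬ |∑ i, (b i : ℝ) * ξ i + c| < 1 / (20 * (3 * (Q : ℝ)) ^ (m + 2)) :=
          fun hlt => hk ⟨b, c, htail, fun i => (hbQ i).le, hlt⟩
        refine le_trans ?_ (not_lt.mp hb')
        gcongr
        norm_num
    calc 1 / (24 * 6 ^ (m + 2))
        = ((Q : ℝ) / 2) ^ (m + 2) * (1 / (24 * (3 * (Q : ℝ)) ^ (m + 2))) := by
          rw [show (6 : ℝ) = 2 * 3 by norm_num, mul_pow, mul_pow, div_pow]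
          field_simp
      _ ≤ f (Q / 2) := by simp only [hf]; gcongr

theorem isometry_vecCons {n : ℕ} (x : ℝ) :
    Isometry (fun v : Fin n → ℝ => (Matrix.vecCons x v : Fin (n + 1) → ℝ)) := by
  refine Isometry.of_dist_eq fun v w => le_antisymm ?_ ?_
  · refine (dist_pi_le_iff dist_nonneg).mpr (Fin.cases (by simp) fun i => ?_)
    simpa using dist_le_pi_dist v w i
  · refine (dist_pi_le_iff dist_nonneg).mpr fun i => ?_
    simpa using dist_le_pi_dist (Matrix.vecCons x v : Fin (n + 1) → ℝ) (Matrix.vecCons x w) i.succ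

theorem le_dimH_of_pi_restrict_ne_zero {m : ℕ} {I : Set ℝ} {s : Set (Fin m → ℝ)}
    (h : (Measure.pi fun _ : Fin m => volume.restrict I) s ≠ 0) :
    (m : ℝ≥0∞) ≤ dimH s := by
  have hvol : volume s ≠ 0 := by
    intro h0
    rw [← Measure.restrict_pi_pi] at h
    exact h (le_antisymm ((Measure.restrict_apply_le _ _).trans h0.le) zero_le)
  have := le_dimH_of_hausdorffMeasure_ne_zero (s := s) (d := (m : NNReal)) (by
    rw [← hausdorffMeasure_pi_real, Fintype.card_fin] at hvol
    simpa using hvol)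
  simpa using this

theorem le_dimH_FSdual (m : ℕ) : (m : ℝ≥0∞) ≤ dimH (FSdual (m + 2)) := by
  obtain ⟨x, y, q, r, hq, hqr, hx, hy, hxy⟩ := exists_interlaced_approximations m
  have hprob : IsProbabilityMeasure (volume.restrict (Set.Icc (0 : ℝ) 1)) := ⟨by simp⟩
  have hpos := frequently_notMem_ne_zero
    (μ := Measure.pi fun _ : Fin m => volume.restrict (Set.Icc (0 : ℝ) 1))
    (E := fun k => resonantSet m x y (q (k + 1)) (1 / (20 * (3 * (q (k + 1) : ℕ)) ^ (m + 2))))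
    (fun k => measurableSet_resonantSet _ _ _ _ _)
    (fun k => measure_resonantSet_le m x y (hqr (k + 1)).1)
  refine (le_dimH_of_pi_restrict_ne_zero hpos).trans ?_
  rw [← ((isometry_vecCons x).comp (isometry_vecCons y)).dimH_image]
  refine dimH_mono ?_
  rintro _ ⟨η, hη, rfl⟩
  exact mem_FSdual_of_frequently hq hqr hx hy hxy hη

/-- for `n ≥ 4`, `dim_H FS_n ≥ n − 2`. -/
theorem dimH_FSdual_ge (n : ℕ) (hn : 4 ≤ n) :
    ((n - 2 : ℕ) : ℝ≥0∞) ≤ dimH (FSdual n) := by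
  obtain ⟨m, rfl⟩ := Nat.exists_eq_add_of_le' (show 2 ≤ n by omega)
  simpa using le_dimH_FSdual m
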